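/- There exists a constant C > 0 such that for every integer n ≥ 2 the following holds. Set K = ⌈(log n)^8⌉ and let x_1, ..., x_n be i.i.d. uniform on [0,1]. Then with probability at least 1 − C/n^{10}: for every integer ℓ with 0 ≤ ℓ ≤ ⌊log n / log K⌋, every j ∈ {1,...,K^ℓ} defining the segment S = [(j−1)/K^ℓ, j/K^ℓ] partitioned into the K equal sub-segments S_k = [(j−1)/K^ℓ + (k−1)/K^{ℓ+1}, (j−1)/K^ℓ + k/K^{ℓ+1}] (k = 1,...,K), every integer i ∈ {1,...,n}, and every integer m ≥ K·(log n)^4, the following implication holds: if at least m of the items x_{n−i+1}, ..., x_n lie in S, then, letting t_1 < t_2 < ... < t_m be the m smallest indices t ∈ {n−i+1,...,n} with x_t ∈ S, for every k ∈ {1,...,K} the number of r ∈ {1,...,m} with x_{t_r} ∈ S_k lies in the range m/K ± (1/20)·d(m/K). -/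

import Mathlib

open MeasureTheory
open scoped Classical

/-- The distribution of `n` i.i.d. uniform samples from `[0,1]`. -/
noncomputable def uniformCube (n : ℕ) : Measure (Fin n → ℝ) :=
  Measure.pi fun _ => (volume : Measure ℝ).restrict (Set.Icc 0 1)

/-- `dFn y = y - ⌈y - (1/2)·y^(2/3)⌉`, so that `⌈y - (1/2)·y^(2/3)⌉ = y - dFn y`. -/
noncomputable def dFn (y : ℝ) : ℝ := y - (⌈y - (1/2) * y ^ ((2:ℝ)/3)⌉ : ℤ)

/-- The parameter `K = ⌈(log n)^8⌉`. -/
noncomputable def Kparam (n : ℕ) : ℕ := ⌈(Real.log n) ^ 8⌉₊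

/-- The set of indices among the last `i` of `{0,…,n-1}` whose item lies in `[a,b]`. -/
noncomputable def lastHits {n : ℕ} (x : Fin n → ℝ) (i : ℕ) (a b : ℝ) : Finset (Fin n) :=
  Finset.univ.filter fun t : Fin n => n - i ≤ (t : ℕ) ∧ x t ∈ Set.Icc a b

/-- The `m` smallest elements of a finset of indices (those whose rank is at most `m`). -/
noncomputable def smallestM {n : ℕ} (F : Finset (Fin n)) (m : ℕ) : Finset (Fin n) :=
  F.filter fun t => (F.filter fun u => u ≤ t).card ≤ m

/-- The number of indices in `F` whose item lies in `[a,b]`. -/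
noncomputable def hitCount {n : ℕ} (x : Fin n → ℝ) (F : Finset (Fin n)) (a b : ℝ) : ℕ :=
  (F.filter fun t => x t ∈ Set.Icc a b).card

theorem smallestM_subset {n : ℕ} (F : Finset (Fin n)) (m : ℕ) : smallestM F m ⊆ F :=
  Finset.filter_subset _ _

theorem card_smallestM {n : ℕ} (F : Finset (Fin n)) (m : ℕ) :
    (smallestM F m).card = min m F.card := by
  induction F using Finset.induction_on_max with
  | empty => simp [smallestM]
  | insert a s ha ih =>
    have has : a ∉ s := fun h => lt_irrefl a (ha a h)
    have hs : s.filter (fun t => ((insert a s).filter fun u => u ≤ t).card ≤ m)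
        = smallestM s m := by
      unfold smallestM
      refine Finset.filter_congr fun t ht => ?_
      rw [Finset.filter_insert, if_neg (not_le.mpr (ha t ht))]
    have hr : ((insert a s).filter fun u => u ≤ a) = insert a s := by
      refine Finset.filter_true_of_mem fun u hu => ?_
      rcases Finset.mem_insert.mp hu with rfl | hu
      · exact le_rfl
      · exact (ha u hu).le
    rw [smallestM, Finset.filter_insert, hs, hr, Finset.card_insert_of_notMem has]
    split_ifs with h
    · rw [Finset.card_insert_of_notMem fun h' => has (smallestM_subset _ _ h'), ih]
      omega
    · rw [ih]; omega

theorem prod_smallestM_succ {n : ℕ} {M : Type*} [CommMonoid M] (F : Finset (Fin (n + 1)))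
    (m : ℕ) (g : Fin (n + 1) → M) :
    ∏ t ∈ smallestM F m, g t =
      if 0 ∈ F ∧ 0 < m then
        g 0 * ∏ t ∈ smallestM (Finset.univ.filter fun t : Fin n => t.succ ∈ F) (m - 1), g t.succ
      else ∏ t ∈ smallestM (Finset.univ.filter fun t : Fin n => t.succ ∈ F) m, g t.succ := by
  have rank_succ (t : Fin n) : (F.filter fun u => u ≤ t.succ).card =
      (if 0 ∈ F then 1 else 0) +
        ((Finset.univ.filter fun t : Fin n => t.succ ∈ F).filter fun u => u ≤ t).card := by
    have : (F.filter fun u => u ≤ t.succ) =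
        Finset.univ.filter fun u => u ∈ F ∧ u ≤ t.succ := by ext; simp
    rw [this, Fin.card_filter_univ_succ, Finset.filter_filter]
    simp only [Fin.zero_le, and_true, Fin.succ_le_succ_iff]
    split_ifs <;> simp [add_comm]
  have rank_zero : (F.filter fun u => u ≤ 0).card = if 0 ∈ F then 1 else 0 := by
    have : (F.filter fun u => u ≤ 0) = if 0 ∈ F then {0} else ∅ := by
      ext u; split_ifs with h <;> simp <;> grind
    rw [this]; split_ifs <;> simp
  have expand (k : ℕ) (G : Finset (Fin k)) (m : ℕ) (g : Fin k → M) :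
      ∏ t ∈ smallestM G m, g t =
        ∏ t, if t ∈ G ∧ (G.filter fun u => u ≤ t).card ≤ m then g t else 1 := by
    rw [← Finset.prod_filter]
    refine Finset.prod_congr ?_ fun _ _ => rfl
    ext t; simp [smallestM]
  have rank_pos (t : Fin n) (ht : t.succ ∈ F) :
      0 < ((Finset.univ.filter fun t : Fin n => t.succ ∈ F).filter fun u => u ≤ t).card :=
    Finset.card_pos.mpr ⟨t, by simp [ht]⟩
  rw [expand _ F, Fin.prod_univ_succ, rank_zero]
  simp only [rank_succ]
  by_cases h0 : 0 ∈ F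
  · by_cases hm : 0 < m
    · simp only [h0, hm, and_self, if_true, true_and, expand, show 1 ≤ m from hm,
        Finset.mem_filter, Finset.mem_univ]
      congr 1
      refine Finset.prod_congr rfl fun t _ => if_congr (and_congr_right fun _ => ?_) rfl rfl
      omega
    · simp only [h0, hm, and_false, if_true, if_false, true_and, expand, show ¬ 1 ≤ m from hm,
        Finset.mem_filter, Finset.mem_univ, one_mul]
      refine Finset.prod_congr rfl fun t _ => if_congr (and_congr_right fun ht => ?_) rfl rfl
      have := rank_pos t ht
      omega
  · simp only [h0, false_and, if_false, true_and, expand, Finset.mem_filter, Finset.mem_univ,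
      one_mul, zero_add]

theorem measurable_prod_smallestM {α : Type*} [MeasurableSpace α] {S : Set α}
    (hS : MeasurableSet S) {w : α → ENNReal} (hw : Measurable w) {n : ℕ} (A : Fin n → Prop)
    (m : ℕ) :
    Measurable fun x : Fin n → α =>
      ∏ t ∈ smallestM (Finset.univ.filter fun t => A t ∧ x t ∈ S) m, w (x t) := by
  have key : (fun x : Fin n → α =>
      ∏ t ∈ smallestM (Finset.univ.filter fun t => A t ∧ x t ∈ S) m, w (x t)) =
      fun x => ∑ G : Finset (Fin n),
        {x : Fin n → α | (Finset.univ.filter fun t => A t ∧ x t ∈ S) = G}.indicator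
          (fun x => ∏ t ∈ smallestM G m, w (x t)) x := by
    funext x
    simp [Set.indicator_apply]
  rw [key]
  refine Finset.measurable_sum _ fun G _ => Measurable.indicator ?_ ?_
  · exact Finset.measurable_prod _ fun t _ => hw.comp (measurable_pi_apply t)
  · simp only [Finset.ext_iff, Finset.mem_filter, Finset.mem_univ, true_and]
    exact measurableSet_setOfPred.mpr (Measurable.forall fun t =>
      ((measurable_const).and (measurableSet_setOfPred.mp ((measurable_pi_apply t) hS))).iff
        measurable_const)

theorem lintegral_prod_smallestM_le_one {α : Type*} [MeasurableSpace α] {μ : Measure α}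
    [IsProbabilityMeasure μ] {S : Set α} (hS : MeasurableSet S) {w : α → ENNReal}
    (hw : Measurable w) (hwS : ∫⁻ a in S, w a ∂μ ≤ μ S) {n : ℕ} (A : Fin n → Prop) (m : ℕ) :
    ∫⁻ x, ∏ t ∈ smallestM (Finset.univ.filter fun t => A t ∧ x t ∈ S) m, w (x t)
      ∂(Measure.pi fun _ : Fin n => μ) ≤ 1 := by
  induction n generalizing m with
  | zero => simp [smallestM]
  | succ n ih =>
    have e := (measurePreserving_piFinSuccAbove (fun _ : Fin (n + 1) => μ) 0).symm
    rw [e.lintegral_map_equiv]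
    refine (lintegral_prod_le _).trans ?_
    have bound (a : α) :
        ∫⁻ y, ∏ t ∈ smallestM (Finset.univ.filter fun t => A t ∧
          ((MeasurableEquiv.piFinSuccAbove (fun _ => α) 0).symm (a, y)) t ∈ S) m,
          w ((MeasurableEquiv.piFinSuccAbove (fun _ => α) 0).symm (a, y) t)
          ∂(Measure.pi fun _ : Fin n => μ) ≤ if A 0 ∧ 0 < m then S.piecewise w 1 a else 1 := by
      simp only [prod_smallestM_succ, MeasurableEquiv.piFinSuccAbove_symm_apply,
        Fin.insertNthEquiv_apply, Fin.insertNth_zero', Fin.cons_zero, Fin.cons_succ,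
        Finset.mem_filter, Finset.mem_univ, true_and]
      by_cases h : A 0 ∧ 0 < m
      · by_cases ha : a ∈ S
        · simp only [h, ha, and_self, if_true, Set.piecewise_eq_of_mem]
          rw [lintegral_const_mul _ (measurable_prod_smallestM hS hw (fun t => A t.succ) (m - 1))]
          exact mul_le_of_le_one_right' (ih (fun t => A t.succ) (m - 1))
        · simp only [ha, and_false, false_and, if_false, Set.piecewise_eq_of_notMem _ _ _ ha, h,
            and_self, if_true]
          exact ih (fun t => A t.succ) m
      · rw [if_neg h]
        by_cases ha : (A 0 ∧ a ∈ S) ∧ 0 < m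
        · exact absurd ⟨ha.1.1, ha.2⟩ h
        · simp only [ha, if_false]
          exact ih (fun t => A t.succ) m
    refine (lintegral_mono bound).trans ?_
    split_ifs
    · rw [lintegral_piecewise hS]
      calc _ ≤ μ S + μ Sᶜ := by gcongr; simp
        _ = 1 := by rw [measure_add_measure_compl hS, measure_univ]
    · simp

theorem setLIntegral_exp_indicator_le {α : Type*} [MeasurableSpace α] {μ : Measure α}
    [IsFiniteMeasure μ] {S T : Set α} (hT : MeasurableSet T)
    (hTS : T ⊆ S) {p : ℝ} (hμ : μ.real T = p * μ.real S) (lam : ℝ) :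
    ∫⁻ a in S, ENNReal.ofReal (Real.exp ((if a ∈ T then lam else 0) -
      p * (Real.exp lam - 1))) ∂μ ≤ μ S := by
  set c := p * (Real.exp lam - 1) with hc
  have hw : (fun a => ENNReal.ofReal (Real.exp ((if a ∈ T then lam else 0) - c))) =
      T.piecewise (fun _ => ENNReal.ofReal (Real.exp (lam - c)))
        (fun _ => ENNReal.ofReal (Real.exp (-c))) := by
    funext a
    by_cases h : a ∈ T <;> simp [h]
  have hdiff : μ.real (S \ T) = μ.real S - μ.real T := measureReal_sdiff hTS hT
  rw [hw, lintegral_piecewise hT, setLIntegral_const, setLIntegral_const,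
    Measure.restrict_apply hT, Measure.restrict_apply hT.compl, Set.inter_eq_left.mpr hTS,
    Set.inter_comm, ← Set.sdiff_eq, ← ofReal_measureReal (μ := μ) (s := T),
    ← ofReal_measureReal (μ := μ) (s := S \ T), ← ofReal_measureReal (μ := μ) (s := S),
    ← ENNReal.ofReal_mul (Real.exp_pos _).le, ← ENNReal.ofReal_mul (Real.exp_pos _).le,
    ← ENNReal.ofReal_add (by positivity) (by positivity)]
  refine ENNReal.ofReal_le_ofReal ?_
  have h1 : Real.exp (lam - c) = Real.exp lam * Real.exp (-c) := by
    rw [← Real.exp_add, sub_eq_add_neg]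
  have h2 : Real.exp (-c) * (1 + c) ≤ 1 := by
    rw [Real.exp_neg, inv_mul_le_one₀ (Real.exp_pos c)]
    linarith [Real.add_one_le_exp c]
  calc _ = Real.exp (-c) * (1 + c) * μ.real S := by rw [hdiff, hμ, h1, hc]; ring
    _ ≤ 1 * μ.real S := by gcongr
    _ = _ := one_mul _

theorem measure_le_card_and_le_mul {α : Type*} [MeasurableSpace α] {μ : Measure α}
    [IsProbabilityMeasure μ] {S T : Set α} (hS : MeasurableSet S) (hT : MeasurableSet T)
    (hTS : T ⊆ S) {p : ℝ} (hμ : μ.real T = p * μ.real S) {n : ℕ}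
    (A : Fin n → Prop) (m : ℕ) (lam z : ℝ) :
    (Measure.pi fun _ : Fin n => μ) {x | m ≤ (Finset.univ.filter fun t => A t ∧ x t ∈ S).card ∧
      z ≤ lam * (((smallestM (Finset.univ.filter fun t => A t ∧ x t ∈ S) m).filter
        fun t => x t ∈ T).card - p * m)} ≤
      ENNReal.ofReal (Real.exp (m * p * (Real.exp lam - 1 - lam) - z)) := by
  set c := p * (Real.exp lam - 1) with hc
  set w : α → ENNReal :=
    fun a => ENNReal.ofReal (Real.exp ((if a ∈ T then lam else 0) - c)) with hw
  have hwm : Measurable w :=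
    (Real.measurable_exp.comp ((Measurable.ite hT measurable_const measurable_const).sub_const
      c)).ennreal_ofReal
  have hprod (F : Finset (Fin n)) (x : Fin n → α) : ∏ t ∈ F, w (x t) =
      ENNReal.ofReal (Real.exp (lam * (F.filter fun t => x t ∈ T).card - c * F.card)) := by
    rw [hw, ← ENNReal.ofReal_prod_of_nonneg fun _ _ => (Real.exp_pos _).le, ← Real.exp_sum,
      Finset.sum_sub_distrib, ← Finset.sum_filter]
    simp [mul_comm]
  have hle := (mul_meas_ge_le_lintegral₀ (μ := Measure.pi fun _ : Fin n => μ)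
    (measurable_prod_smallestM hS hwm A m).aemeasurable
    (ENNReal.ofReal (Real.exp (z + lam * p * m - c * m)))).trans
    (lintegral_prod_smallestM_le_one hS hwm (setLIntegral_exp_indicator_le hT hTS hμ lam) A m)
  have hinv : ENNReal.ofReal (Real.exp (m * p * (Real.exp lam - 1 - lam) - z)) =
      (ENNReal.ofReal (Real.exp (z + lam * p * m - c * m)))⁻¹ := by
    rw [← ENNReal.ofReal_inv_of_pos (Real.exp_pos _), ← Real.exp_neg, hc]
    ring_nf
  rw [hinv, ENNReal.le_inv_iff_mul_le, mul_comm]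
  refine le_trans ?_ hle
  gcongr with x
  rintro ⟨hm, hz⟩
  rw [hprod, card_smallestM, min_eq_left hm]
  gcongr
  linarith

theorem measure_le_card_and_le_abs {α : Type*} [MeasurableSpace α] {μ : Measure α}
    [IsProbabilityMeasure μ] {S T : Set α} (hS : MeasurableSet S) (hT : MeasurableSet T)
    (hTS : T ⊆ S) {p : ℝ} (hμ : μ.real T = p * μ.real S) {n : ℕ}
    (A : Fin n → Prop) (m : ℕ) (hpm : 0 < m * p) {s : ℝ} (hs0 : 0 ≤ s) (hs : s ≤ 2 * (m * p)) :
    (Measure.pi fun _ : Fin n => μ) {x | m ≤ (Finset.univ.filter fun t => A t ∧ x t ∈ S).card ∧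
      s ≤ |(((smallestM (Finset.univ.filter fun t => A t ∧ x t ∈ S) m).filter
        fun t => x t ∈ T).card : ℝ) - p * m|} ≤
      ENNReal.ofReal (2 * Real.exp (-(s ^ 2 / (4 * (m * p))))) := by
  set y : ℝ := m * p with hy
  set l := s / (2 * y) with hl
  have hl0 : 0 ≤ l := by positivity
  have hl1 : l ≤ 1 := by rw [hl, div_le_one (by positivity)]; exact hs
  have tail (lam : ℝ) (h : |lam| = l) :
      (Measure.pi fun _ : Fin n => μ) {x |
        m ≤ (Finset.univ.filter fun t => A t ∧ x t ∈ S).card ∧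
        l * s ≤ lam * (((smallestM (Finset.univ.filter fun t => A t ∧ x t ∈ S) m).filter
        fun t => x t ∈ T).card - p * m)} ≤
        ENNReal.ofReal (Real.exp (-(s ^ 2 / (4 * y)))) := by
    refine (measure_le_card_and_le_mul hS hT hTS hμ A m lam (l * s)).trans ?_
    gcongr
    have h1 := (abs_le.mp (Real.abs_exp_sub_one_sub_id_le (h.trans_le hl1))).2
    rw [← sq_abs, h] at h1
    calc _ ≤ y * l ^ 2 - l * s := by gcongr
      _ = _ := by rw [hl]; field_simp; ring
  rw [two_mul, ENNReal.ofReal_add (Real.exp_pos _).le (Real.exp_pos _).le]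
  refine le_trans ?_ (add_le_add (tail l (abs_of_nonneg hl0))
    (tail (-l) (by rw [abs_neg, abs_of_nonneg hl0])))
  refine (measure_mono ?_).trans (measure_union_le _ _)
  rintro x ⟨hm, hx⟩
  rcases le_abs.mp hx with h | h
  · exact Or.inl ⟨hm, mul_le_mul_of_nonneg_left h hl0⟩
  · refine Or.inr ⟨hm, ?_⟩
    rw [neg_mul, ← mul_neg]
    exact mul_le_mul_of_nonneg_left h hl0

theorem rpow_two_thirds_le_dFn {y : ℝ} (hy : 1000 ≤ y) :
    y ^ ((2 : ℝ) / 3) / 50 ≤ (1 / 20) * dFn y := by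
  have h100 : (100 : ℝ) ≤ y ^ ((2 : ℝ) / 3) := by
    calc (100 : ℝ) = (1000 : ℝ) ^ ((2 : ℝ) / 3) := by
          rw [show (1000 : ℝ) = 10 ^ (3 : ℝ) by norm_num, ← Real.rpow_mul (by norm_num)]
          norm_num
      _ ≤ _ := by gcongr
  have := Int.ceil_lt_add_one (y - (1 / 2) * y ^ ((2 : ℝ) / 3))
  unfold dFn
  linarith

theorem restrict_unit_real_Icc {c d : ℝ} (hc : 0 ≤ c) (hcd : c ≤ d) (hd : d ≤ 1) :
    ((volume : Measure ℝ).restrict (Set.Icc 0 1)).real (Set.Icc c d) = d - c := by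
  rw [measureReal_restrict_apply measurableSet_Icc,
    Set.inter_eq_left.mpr (Set.Icc_subset_Icc hc hd), Real.volume_real_Icc_of_le hcd]

instance isProbabilityMeasure_restrict_unit :
    IsProbabilityMeasure ((volume : Measure ℝ).restrict (Set.Icc 0 1)) :=
  ⟨by simp⟩

instance isProbabilityMeasure_uniformCube (n : ℕ) : IsProbabilityMeasure (uniformCube n) := by
  unfold uniformCube; infer_instance

theorem uniformCube_subsegment_deviation_le {n K l j i m k : ℕ} (hj : 1 ≤ j) (hjK : j ≤ K ^ l)
    (hk : 1 ≤ k) (hkK : k ≤ K) (hm : 1000 ≤ (m : ℝ) / K) :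
    uniformCube n {x | m ≤ (lastHits x i (((j : ℝ) - 1) / (K : ℝ) ^ l)
          ((j : ℝ) / (K : ℝ) ^ l)).card ∧
        (1 / 20) * dFn ((m : ℝ) / K) <
          |(hitCount x (smallestM (lastHits x i (((j : ℝ) - 1) / (K : ℝ) ^ l)
              ((j : ℝ) / (K : ℝ) ^ l)) m)
            (((j : ℝ) - 1) / (K : ℝ) ^ l + ((k : ℝ) - 1) / (K : ℝ) ^ (l + 1))
            (((j : ℝ) - 1) / (K : ℝ) ^ l + (k : ℝ) / (K : ℝ) ^ (l + 1)) : ℝ)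
            - (m : ℝ) / K|} ≤
      ENNReal.ofReal (2 * Real.exp (-(((m : ℝ) / K) ^ ((1 : ℝ) / 3) / 10000))) := by
  have hK : (0 : ℝ) < K := by exact_mod_cast (by omega : 0 < K)
  have hj' : (1 : ℝ) ≤ j := by exact_mod_cast hj
  have hjK' : (j : ℝ) ≤ (K : ℝ) ^ l := by exact_mod_cast hjK
  have hk' : (1 : ℝ) ≤ k := by exact_mod_cast hk
  have hkK' : (k : ℝ) ≤ K := by exact_mod_cast hkK
  have ha : 0 ≤ ((j : ℝ) - 1) / (K : ℝ) ^ l := div_nonneg (by linarith) (by positivity)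
  have hb : (j : ℝ) / (K : ℝ) ^ l ≤ 1 := (div_le_one (by positivity)).mpr hjK'
  have hab : ((j : ℝ) - 1) / (K : ℝ) ^ l ≤ (j : ℝ) / (K : ℝ) ^ l := by gcongr; linarith
  have hac : 0 ≤ ((k : ℝ) - 1) / (K : ℝ) ^ (l + 1) := div_nonneg (by linarith) (by positivity)
  have hcd : ((k : ℝ) - 1) / (K : ℝ) ^ (l + 1) ≤ (k : ℝ) / (K : ℝ) ^ (l + 1) := by
    gcongr; linarith
  have hdb : ((j : ℝ) - 1) / (K : ℝ) ^ l + (k : ℝ) / (K : ℝ) ^ (l + 1) ≤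
      (j : ℝ) / (K : ℝ) ^ l := by
    have : (k : ℝ) / (K : ℝ) ^ (l + 1) ≤ 1 / (K : ℝ) ^ l := by
      rw [pow_succ, div_le_div_iff₀ (by positivity) (by positivity), one_mul, mul_comm]
      gcongr
    rw [sub_div]
    linarith
  set y : ℝ := (m : ℝ) / K with hy
  have hy0 : 0 < y := by linarith
  have hmp : (m : ℝ) * (1 / K) = y := by rw [hy]; ring
  have hs : (y ^ ((2 : ℝ) / 3) / 50) ≤ 2 * y := by
    have : y ^ ((2 : ℝ) / 3) ≤ y ^ (1 : ℝ) := by gcongr <;> linarith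
    rw [Real.rpow_one] at this
    linarith
  have hexp : (y ^ ((2 : ℝ) / 3) / 50) ^ 2 / (4 * y) = y ^ ((1 : ℝ) / 3) / 10000 := by
    have : (y ^ ((2 : ℝ) / 3)) ^ 2 = y ^ ((1 : ℝ) / 3) * y := by
      rw [← Real.rpow_natCast, ← Real.rpow_mul hy0.le]
      nth_rewrite 3 [← Real.rpow_one y]
      rw [← Real.rpow_add hy0]
      norm_num
    rw [div_pow, this]
    field_simp
    norm_num
  have main := measure_le_card_and_le_abs (μ := (volume : Measure ℝ).restrict (Set.Icc 0 1))
    (S := Set.Icc (((j : ℝ) - 1) / (K : ℝ) ^ l) ((j : ℝ) / (K : ℝ) ^ l))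
    (T := Set.Icc (((j : ℝ) - 1) / (K : ℝ) ^ l + ((k : ℝ) - 1) / (K : ℝ) ^ (l + 1))
      (((j : ℝ) - 1) / (K : ℝ) ^ l + (k : ℝ) / (K : ℝ) ^ (l + 1)))
    measurableSet_Icc measurableSet_Icc
    (Set.Icc_subset_Icc (by linarith) hdb) (p := 1 / K)
    (by
      rw [restrict_unit_real_Icc (by linarith) (by linarith) (by linarith),
        restrict_unit_real_Icc ha hab hb]
      field_simp
      ring)
    (fun t : Fin n => n - i ≤ (t : ℕ)) m (by rw [hmp]; exact hy0)
    (s := y ^ ((2 : ℝ) / 3) / 50) (by positivity) (by rw [hmp]; exact hs)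
  rw [hmp, hexp] at main
  refine le_trans (measure_mono ?_) main
  rintro x ⟨h1, h2⟩
  refine ⟨by unfold lastHits at h1; convert h1, ?_⟩
  rw [mul_comm (1 / (K : ℝ)), hmp]
  refine (rpow_two_thirds_le_dFn hm).trans (h2.le.trans_eq ?_)
  unfold hitCount lastHits
  congr!

theorem eventually_log_large_and_Kparam_le :
    ∀ᶠ n : ℕ in Filter.atTop, (150000 : ℝ) ^ 3 ≤ Real.log n ∧ Kparam n ≤ n := by
  have h1 := (Real.tendsto_log_atTop.comp tendsto_natCast_atTop_atTop).eventually_ge_atTop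
    ((150000 : ℝ) ^ 3)
  have h2 := (Real.isLittleO_pow_log_id_atTop (n := 8)).bound one_pos
  filter_upwards [h1, tendsto_natCast_atTop_atTop.eventually h2] with n hn1 hn2
  refine ⟨hn1, Nat.ceil_le.mpr ?_⟩
  simpa using (le_abs_self _).trans hn2

theorem exp_neg_rpow_third_le {n : ℕ} (hn : n ≠ 0) (hlog : (150000 : ℝ) ^ 3 ≤ Real.log n)
    {y : ℝ} (hy : Real.log n ^ 4 ≤ y) :
    Real.exp (-(y ^ ((1 : ℝ) / 3) / 10000)) ≤ 1 / (n : ℝ) ^ 15 := by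
  set L := Real.log n with hL
  have hL0 : 0 < L := lt_of_lt_of_le (by positivity) hlog
  have h1 : (150000 : ℝ) * L ≤ y ^ ((1 : ℝ) / 3) := by
    rw [one_div, Real.le_rpow_inv_iff_of_pos (by positivity)
      ((by positivity : 0 ≤ L ^ 4).trans hy) (by norm_num)]
    norm_cast
    calc _ = (150000 : ℝ) ^ 3 * L ^ 3 := by norm_num; ring
      _ ≤ L * L ^ 3 := by gcongr
      _ ≤ y := by linarith [hy, (by ring : L * L ^ 3 = L ^ 4)]
  have hn0 : (0 : ℝ) < n := by positivity
  calc _ ≤ Real.exp (-(15 * L)) := by gcongr; linarith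
    _ = _ := by
      rw [Real.exp_neg, one_div, show (15 : ℝ) * L = (15 : ℕ) * L by norm_num,
        Real.exp_nat_mul, hL, Real.exp_log hn0]

theorem pow_le_of_le_log_div_log {n K l : ℕ} (hn : n ≠ 0) (hK : 2 ≤ K)
    (hl : (l : ℝ) ≤ Real.log n / Real.log K) : K ^ l ≤ n := by
  have hK' : (1 : ℝ) < K := by exact_mod_cast hK
  rw [le_div_iff₀ (Real.log_pos hK'), ← Real.log_pow,
    Real.log_le_log_iff (by positivity) (by positivity)] at hl
  exact_mod_cast hl

theorem ofReal_one_sub_le_of_compl_subset_biUnion {Ω ι : Type*} [MeasurableSpace Ω]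
    {P : Measure Ω} [IsProbabilityMeasure P] {G : Set Ω} {I : Finset ι} {B : ι → Set Ω}
    (hG : Gᶜ ⊆ ⋃ q ∈ I, B q) {e : ℝ} (he : 0 ≤ e) (hB : ∀ q ∈ I, P (B q) ≤ ENNReal.ofReal e) :
    ENNReal.ofReal (1 - I.card * e) ≤ P G := by
  have h : P Gᶜ ≤ ENNReal.ofReal (I.card * e) := by
    refine (measure_mono hG).trans ((measure_biUnion_finset_le _ _).trans ?_)
    refine (Finset.sum_le_card_nsmul _ _ _ hB).trans_eq ?_
    rw [nsmul_eq_mul, ENNReal.ofReal_mul (by positivity), ENNReal.ofReal_natCast]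
  rw [ENNReal.ofReal_sub _ (by positivity), ENNReal.ofReal_one, tsub_le_iff_right]
  calc (1 : ENNReal) = P (G ∪ Gᶜ) := by rw [Set.union_compl_self, measure_univ]
    _ ≤ P G + P Gᶜ := measure_union_le _ _
    _ ≤ _ := by gcongr

/-- With probability `1 - O(1/n^10)`: for every segment `S` at scale `ℓ`, every `i`,
and every `m ≥ K·(log n)^4`, if at least `m` of the last `i` items lie in `S`, then
among the `m` earliest such items, each of the `K` equal sub-segments of `S` receives
`m/K ± (1/20)·d(m/K)` of them. -/
theorem subsegment_counts_concentration :
    ∃ C : ℝ, 0 < C ∧ ∀ n : ℕ, 2 ≤ n →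
      ENNReal.ofReal (1 - C / (n : ℝ) ^ 10) ≤
        uniformCube n
          {x | ∀ ℓ : ℕ, (ℓ : ℝ) ≤ Real.log n / Real.log (Kparam n) →
            ∀ j : ℕ, 1 ≤ j → j ≤ Kparam n ^ ℓ →
            ∀ i : ℕ, i ≤ n →
            ∀ m : ℕ, (Kparam n : ℝ) * (Real.log n) ^ 4 ≤ (m : ℝ) →
              m ≤ (lastHits x i (((j : ℝ) - 1) / (Kparam n : ℝ) ^ ℓ)
                    ((j : ℝ) / (Kparam n : ℝ) ^ ℓ)).card →
              ∀ k : ℕ, 1 ≤ k → k ≤ Kparam n →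
                |(hitCount x
                      (smallestM (lastHits x i (((j : ℝ) - 1) / (Kparam n : ℝ) ^ ℓ)
                        ((j : ℝ) / (Kparam n : ℝ) ^ ℓ)) m)
                      (((j : ℝ) - 1) / (Kparam n : ℝ) ^ ℓ
                        + ((k : ℝ) - 1) / (Kparam n : ℝ) ^ (ℓ + 1))
                      (((j : ℝ) - 1) / (Kparam n : ℝ) ^ ℓ
                        + (k : ℝ) / (Kparam n : ℝ) ^ (ℓ + 1)) : ℝ)
                    - (m : ℝ) / (Kparam n : ℝ)|
                  ≤ (1/20) * dFn ((m : ℝ) / (Kparam n : ℝ))} := by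
  obtain ⟨N, hN⟩ := Filter.eventually_atTop.mp eventually_log_large_and_Kparam_le
  refine ⟨64 + (N : ℝ) ^ 10, by positivity, fun n hn => ?_⟩
  have hn0 : (0 : ℝ) < n := by positivity
  rcases lt_or_ge n N with hnN | hnN
  · have : (n : ℝ) ≤ N := by exact_mod_cast hnN.le
    rw [ENNReal.ofReal_of_nonpos]
    · exact zero_le
    · rw [sub_nonpos, one_le_div (by positivity)]
      have : (n : ℝ) ^ 10 ≤ (N : ℝ) ^ 10 := by gcongr
      linarith
  obtain ⟨hlog, hKn⟩ := hN n hnN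
  have hL8 : Real.log n ^ 8 ≤ Kparam n := Nat.le_ceil _
  have hL : (1000 : ℝ) ≤ Real.log n := le_trans (by norm_num) hlog
  have hL4 : (1000 : ℝ) ≤ Real.log n ^ 4 := hL.trans (le_self_pow₀ (by linarith) (by norm_num))
  have hK2 : 2 ≤ Kparam n := by
    have : (1000 : ℝ) ≤ Kparam n :=
      (hL.trans (le_self_pow₀ (by linarith) (by norm_num))).trans hL8
    exact_mod_cast (by linarith : (2 : ℝ) ≤ Kparam n)
  generalize Kparam n = K at *
  have hK0 : (0 : ℝ) < K := by positivity
  let R := Finset.range (n + 1)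
  let B : ℕ × ℕ × ℕ × ℕ × ℕ → Set (Fin n → ℝ) := fun (l, j, i, m, k) =>
    {x | (1 ≤ j ∧ j ≤ K ^ l ∧ 1 ≤ k ∧ k ≤ K ∧ Real.log n ^ 4 ≤ (m : ℝ) / K) ∧
      m ≤ (lastHits x i (((j : ℝ) - 1) / (K : ℝ) ^ l) ((j : ℝ) / (K : ℝ) ^ l)).card ∧
        (1 / 20) * dFn ((m : ℝ) / K) <
          |(hitCount x (smallestM (lastHits x i (((j : ℝ) - 1) / (K : ℝ) ^ l)
              ((j : ℝ) / (K : ℝ) ^ l)) m)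
            (((j : ℝ) - 1) / (K : ℝ) ^ l + ((k : ℝ) - 1) / (K : ℝ) ^ (l + 1))
            (((j : ℝ) - 1) / (K : ℝ) ^ l + (k : ℝ) / (K : ℝ) ^ (l + 1)) : ℝ)
            - (m : ℝ) / K|}
  refine le_trans ?_ (ofReal_one_sub_le_of_compl_subset_biUnion
    (I := R ×ˢ R ×ˢ R ×ˢ R ×ˢ R) (B := B) (e := 2 * (1 / (n : ℝ) ^ 15)) ?_ (by positivity) ?_)
  · refine ENNReal.ofReal_le_ofReal (sub_le_sub_left ?_ 1)
    simp only [Finset.card_product, R, Finset.card_range]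
    push_cast
    have h1 : (n : ℝ) + 1 ≤ 2 * n := by
      have : (2 : ℝ) ≤ n := by exact_mod_cast hn
      linarith
    calc _ ≤ (2 * n : ℝ) * ((2 * n) * ((2 * n) * ((2 * n) * (2 * n)))) *
          (2 * (1 / (n : ℝ) ^ 15)) := by gcongr
      _ = 64 / (n : ℝ) ^ 10 := by field_simp; norm_num
      _ ≤ _ := by gcongr; exact le_add_of_nonneg_right (by positivity)
  · intro x hx
    simp only [Set.mem_compl_iff, Set.mem_ofPred_eq, not_forall, not_le] at hx
    obtain ⟨l, hl, j, hj, hjK, i, hi, m, hm, hcard, k, hk, hkK, hdev⟩ := hx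
    have hKl : K ^ l ≤ n := pow_le_of_le_log_div_log (by omega) hK2 hl
    have hln : l ≤ n := (Nat.lt_pow_self hK2).le.trans hKl
    have hmn : m ≤ n := hcard.trans ((Finset.card_le_univ _).trans_eq (Fintype.card_fin n))
    refine Set.mem_biUnion (x := (l, j, i, m, k)) ?_
      ⟨⟨hj, hjK, hk, hkK, ?_⟩, hcard, hdev⟩
    · simp only [R, Finset.coe_product, Set.mem_prod, Finset.coe_range, Set.mem_Iio]
      omega
    · rwa [le_div_iff₀ hK0, mul_comm]
  · rintro ⟨l, j, i, m, k⟩ -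
    by_cases h : 1 ≤ j ∧ j ≤ K ^ l ∧ 1 ≤ k ∧ k ≤ K ∧ Real.log n ^ 4 ≤ (m : ℝ) / K
    · obtain ⟨hj, hjK, hk, hkK, hm⟩ := h
      refine (measure_mono fun x hx => hx.2).trans
        ((uniformCube_subsegment_deviation_le (i := i) hj hjK hk hkK (hL4.trans hm)).trans ?_)
      gcongr
      exact exp_neg_rpow_third_le (by omega) hlog hm
    · simp [B, h]
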